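/- Let p : ℝⁿ → ℝ be continuously differentiable and everywhere positive, and let φ : ℝⁿ → ℝ be twice continuously differentiable such that ∇φ has compact support. Then ∫ ⟨∇log p(x), ∇φ(x)⟩ p(x) dx = − ∫ (Δφ)(x) p(x) dx, where Δφ = Σ_{d=1}^{n} ∂²φ/∂x_d² is the Laplacian and the integrals are with respect to Lebesgue measure on ℝⁿ. -/

import Mathlib

open MeasureTheory
open scoped RealInnerProductSpace

/-- The divergence `div f = Σ_d ∂f_d/∂x_d` of a vector field on `ℝⁿ`. -/
noncomputable def diverg {n : ℕ}
    (f : EuclideanSpace ℝ (Fin n) → EuclideanSpace ℝ (Fin n))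
    (x : EuclideanSpace ℝ (Fin n)) : ℝ :=
  ∑ d : Fin n, fderiv ℝ f x (EuclideanSpace.single d 1) d

/-- The Laplacian `Δφ = Σ_d ∂²φ/∂x_d²`, i.e. the divergence of the gradient. -/
noncomputable def laplacian {n : ℕ}
    (φ : EuclideanSpace ℝ (Fin n) → ℝ) (x : EuclideanSpace ℝ (Fin n)) : ℝ :=
  diverg (fun y => gradient φ y) x

/-- **Integration by parts**: for a `C¹` function `p` and a compactly supported `C¹` vector field
`F` on `ℝⁿ`, `∫ ⟨∇p, F⟩ = − ∫ (div F) p`. -/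
theorem integral_inner_gradient_eq_neg_integral_diverg_mul {n : ℕ}
    {p : EuclideanSpace ℝ (Fin n) → ℝ} (hp : ContDiff ℝ 1 p)
    {F : EuclideanSpace ℝ (Fin n) → EuclideanSpace ℝ (Fin n)}
    (hF : ContDiff ℝ 1 F) (hFsupp : HasCompactSupport F) :
    ∫ x, ⟪gradient p x, F x⟫ = -∫ x, diverg F x * p x := by
  have hcoord (d : Fin n) : ContDiff ℝ 1 fun x => F x d :=
    (EuclideanSpace.proj (𝕜 := ℝ) d).contDiff.comp hF
  have hsupp (d : Fin n) : HasCompactSupport fun x => F x d :=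
    hFsupp.comp_left (g := fun y : EuclideanSpace ℝ (Fin n) => y d) rfl
  have hderiv (d : Fin n) (x v : EuclideanSpace ℝ (Fin n)) :
      fderiv ℝ (fun y => F y d) x v = fderiv ℝ F x v d := by
    have h := (EuclideanSpace.proj (𝕜 := ℝ) d).hasFDerivAt.comp x
      (hF.differentiable one_ne_zero x).hasFDerivAt
    exact congrArg (· v) h.fderiv
  have hp' (v : EuclideanSpace ℝ (Fin n)) : Continuous fun x => fderiv ℝ p x v :=
    (hp.continuous_fderiv one_ne_zero).clm_apply continuous_const
  have hF' (d : Fin n) (v : EuclideanSpace ℝ (Fin n)) :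
      Continuous fun x => fderiv ℝ (fun y => F y d) x v :=
    ((hcoord d).continuous_fderiv one_ne_zero).clm_apply continuous_const
  have hint₁ (d : Fin n) (v : EuclideanSpace ℝ (Fin n)) :
      Integrable fun x => fderiv ℝ p x v * F x d :=
    ((hp' v).mul (hcoord d).continuous).integrable_of_hasCompactSupport (hsupp d).mul_left
  have hint₂ (d : Fin n) (v : EuclideanSpace ℝ (Fin n)) :
      Integrable fun x => p x * fderiv ℝ (fun y => F y d) x v :=
    (hp.continuous.mul (hF' d v)).integrable_of_hasCompactSupport
      ((hsupp d).fderiv_apply ℝ v).mul_left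
  have hint₃ (d : Fin n) : Integrable fun x => p x * F x d :=
    (hp.continuous.mul (hcoord d).continuous).integrable_of_hasCompactSupport (hsupp d).mul_left
  have hinner (x : EuclideanSpace ℝ (Fin n)) :
      ⟪gradient p x, F x⟫ = ∑ d, fderiv ℝ p x (EuclideanSpace.single d 1) * F x d := by
    rw [inner_gradient_left]
    conv_lhs => rw [← (EuclideanSpace.basisFun (Fin n) ℝ).sum_repr (F x)]
    simp [mul_comm]
  have hdiv (x : EuclideanSpace ℝ (Fin n)) :
      diverg F x * p x
        = ∑ d, p x * fderiv ℝ (fun y => F y d) x (EuclideanSpace.single d 1) := by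
    simp only [diverg, hderiv, Finset.mul_sum, mul_comm]
  simp only [hinner, hdiv]
  rw [integral_finsetSum _ fun d _ => hint₁ d _, integral_finsetSum _ fun d _ => hint₂ d _,
    ← Finset.sum_neg_distrib]
  refine Finset.sum_congr rfl fun d _ => ?_
  rw [integral_mul_fderiv_eq_neg_fderiv_mul_of_integrable (hint₁ d _) (hint₂ d _) (hint₃ d)
    (fun x _ => hp.differentiable one_ne_zero x)
    (fun x _ => (hcoord d).differentiable one_ne_zero x), neg_neg]

/-- The score `∇log p` satisfies `p ∇log p = ∇p`. -/
theorem inner_gradient_log_mul {E : Type*} [NormedAddCommGroup E] [InnerProductSpace ℝ E]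
    [CompleteSpace E] {p : E → ℝ} {x : E} (hp : DifferentiableAt ℝ p x) (hx : p x ≠ 0) (v : E) :
    ⟪gradient (fun y => Real.log (p y)) x, v⟫ * p x = ⟪gradient p x, v⟫ := by
  rw [inner_gradient_left, inner_gradient_left, fderiv.log hp hx]
  simp [field]

theorem ContDiff.gradient_of_two {E : Type*} [NormedAddCommGroup E] [InnerProductSpace ℝ E]
    [CompleteSpace E] {φ : E → ℝ} (hφ : ContDiff ℝ 2 φ) : ContDiff ℝ 1 (gradient φ) :=
  (InnerProductSpace.toDual ℝ E).symm.contDiff.comp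
    (hφ.fderiv_right (m := 1) (by norm_num))

/-- **The score-matching cross-term identity.** For a continuously differentiable,
everywhere positive `p : ℝⁿ → ℝ` and a twice continuously differentiable `φ : ℝⁿ → ℝ`
whose gradient has compact support,
`∫ ⟨∇log p, ∇φ⟩ p dx = − ∫ (Δφ) p dx`. -/
theorem score_matching_cross_term
    (n : ℕ)
    (p : EuclideanSpace ℝ (Fin n) → ℝ)
    (hp : ContDiff ℝ 1 p) (hppos : ∀ x, 0 < p x)
    (φ : EuclideanSpace ℝ (Fin n) → ℝ)
    (hφ : ContDiff ℝ 2 φ)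
    (hφsupp : HasCompactSupport (fun y => gradient φ y)) :
    ∫ x, ⟪gradient (fun y => Real.log (p y)) x, gradient φ x⟫ * p x
      = -∫ x, laplacian φ x * p x := by
  simp only [laplacian, inner_gradient_log_mul (hp.differentiable one_ne_zero _) (hppos _).ne']
  exact integral_inner_gradient_eq_neg_integral_diverg_mul hp hφ.gradient_of_two hφsupp
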